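/- arXiv:1401.4542 — 7 statements merged into one kernel-verified Lean document; each statement's English description precedes it below -/
import Mathlib

section
/- Let 0 < a < b be real numbers and m > 0 with log(b/a) = m. Then there exists an infinitely differentiable function φ: ℝ → ℝ that is even, nonnegative, has support contained in {x : a < |x| < b}, satisfies φ(x) ≤ 2/(m x) for every x > 0, and satisfies ∫_0^∞ φ(x) dx = 1. -/
open MeasureTheory Set

/-- The change of variables `x = exp t` on the positive half-line. -/
theorem integral_Ioi_comp_log_div_abs (g : ℝ → ℝ) :
    ∫ x in Ioi (0 : ℝ), g (Real.log x) / |x| = ∫ t, g t := by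
  have h := integral_image_eq_integral_abs_deriv_smul (s := univ) MeasurableSet.univ
    (fun t _ => (Real.hasDerivAt_exp t).hasDerivWithinAt) Real.exp_injective.injOn
    (fun x => g (Real.log x) / |x|)
  rw [image_univ, Real.range_exp, setIntegral_univ] at h
  rw [h]
  congr 1 with t
  simp only [Real.log_exp, Real.abs_exp, smul_eq_mul]
  field_simp

/-- Composing a smooth function that vanishes near `-∞` with the logarithm and dividing by `|x|`
gives a function that is smooth also at the origin. -/
theorem contDiff_comp_log_div_abs {n : ℕ∞} {g : ℝ → ℝ} {l : ℝ} (hg : ContDiff ℝ n g)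
    (hl : ∀ t ≤ l, g t = 0) : ContDiff ℝ n (fun x => g (Real.log x) / |x|) := by
  rw [contDiff_iff_contDiffAt]
  intro x
  rcases eq_or_ne x 0 with rfl | hx
  · refine (contDiffAt_const (c := (0 : ℝ))).congr_of_eventuallyEq ?_
    filter_upwards [Metric.ball_mem_nhds (0 : ℝ) (Real.exp_pos l)] with y hy
    rcases eq_or_ne y 0 with rfl | hy0
    · simp
    · rw [hl, zero_div]
      rw [← Real.log_abs, Real.log_le_iff_le_exp (abs_pos.2 hy0)]
      simpa using (mem_ball_zero_iff.1 hy).le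
  · exact (hg.contDiffAt.comp x (Real.contDiffAt_log.2 hx)).div (contDiffAt_abs hx)
      (abs_ne_zero.2 hx)

/-- Existence of the Yamada–Watanabe mollifier: for `0 < a < b` and `m > 0` with
`log (b/a) = m`, there is a smooth, even, nonnegative function `φ` supported in
`{x : a < |x| < b}` with `φ x ≤ 2/(m x)` for `x > 0` and `∫_0^∞ φ = 1`. -/
theorem stmt1 (a b m : ℝ) (ha : 0 < a) (hab : a < b) (hm : 0 < m)
    (hlog : Real.log (b / a) = m) :
    ∃ φ : ℝ → ℝ,
      ContDiff ℝ (⊤ : ℕ∞) φ ∧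
      (∀ x, φ (-x) = φ x) ∧
      (∀ x, 0 ≤ φ x) ∧
      (Function.support φ ⊆ {x : ℝ | a < |x| ∧ |x| < b}) ∧
      (∀ x, 0 < x → φ x ≤ 2 / (m * x)) ∧
      (∫ x in Ioi (0 : ℝ), φ x) = 1 := by
  have hb : 0 < b := ha.trans hab
  rw [Real.log_div hb.ne' ha.ne'] at hlog
  let f : ContDiffBump ((Real.log a + Real.log b) / 2) :=
    ⟨m / 4, m / 2, by positivity, by linarith⟩
  have hsupp : ∀ t, f.normed volume t ≠ 0 → Real.log a < t ∧ t < Real.log b := by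
    intro t ht
    rw [← Function.mem_support, f.support_normed_eq, Real.ball_eq_Ioo] at ht
    change _ - m / 2 < t ∧ t < _ + m / 2 at ht
    constructor <;> linarith [ht.1, ht.2]
  refine ⟨fun x => f.normed volume (Real.log x) / |x|, ?_, ?_, ?_, ?_, ?_, ?_⟩
  · refine contDiff_comp_log_div_abs (l := Real.log a) f.contDiff_normed fun t ht => ?_
    by_contra h
    exact (hsupp t h).1.not_ge ht
  · simp
  · exact fun x => div_nonneg (f.nonneg_normed _) (abs_nonneg x)
  · intro x hx
    obtain ⟨hf, hx0⟩ := div_ne_zero_iff.1 hx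
    have h := hsupp _ hf
    have hpos : 0 < |x| := lt_of_le_of_ne (abs_nonneg x) hx0.symm
    rw [← Real.log_abs x, Real.log_lt_log_iff ha hpos, Real.log_lt_log_iff hpos hb] at h
    exact h
  · intro x hx
    have h := f.normed_le_div_measure_closedBall_rIn volume (Real.log x)
    have hr : f.rIn = m / 4 := rfl
    rw [Real.volume_real_closedBall f.rIn_pos.le, hr] at h
    calc f.normed volume (Real.log x) / |x| ≤ 1 / (2 * (m / 4)) / x := by
          rw [abs_of_pos hx]; gcongr
      _ = 2 / (m * x) := by field_simp; norm_num
  · rw [integral_Ioi_comp_log_div_abs, f.integral_normed]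
end

section
/- Let 0 < a < b and let φ: ℝ → ℝ be continuous, nonnegative, even, with support contained in {x : a ≤ |x| ≤ b} and ∫_0^∞ φ(z) dz = 1. Define u(x) = ∫_0^{|x|} ∫_0^y φ(z) dz dy for x ∈ ℝ. Then u is twice continuously differentiable with u''(x) = φ(x) for all x, |u'(x)| ≤ 1 for all x, and |x| - b ≤ u(x) ≤ |x| for all x ∈ ℝ. -/
open MeasureTheory Set intervalIntegral

/-- The primitive based at `0` of an even function is odd. -/
theorem integral_zero_neg_of_even {f : ℝ → ℝ} (hf : ∀ x, f (-x) = f x) (y : ℝ) :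
    (∫ z in (0 : ℝ)..(-y), f z) = -∫ z in (0 : ℝ)..y, f z := by
  have h := integral_comp_neg (a := 0) (b := y) f
  simp only [hf, neg_zero] at h
  rw [h, integral_symm]

/-- The primitive based at `0` of an odd function is even. -/
theorem integral_zero_neg_of_odd {f : ℝ → ℝ} (hf : ∀ x, f (-x) = -f x) (y : ℝ) :
    (∫ z in (0 : ℝ)..(-y), f z) = ∫ z in (0 : ℝ)..y, f z := by
  have h := integral_comp_neg (a := 0) (b := y) f
  simp only [hf, neg_zero, intervalIntegral.integral_neg] at h
  rw [integral_symm, ← h, neg_neg]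

/-- The Yamada–Watanabe test function `u(x) = ∫_0^{|x|} ∫_0^y φ(z) dz dy` built from a
continuous, nonnegative, even mollifier `φ` supported in `{a ≤ |x| ≤ b}` with
`∫_0^∞ φ = 1` is `C²` with `u'' = φ`, `|u'| ≤ 1`, and `|x| - b ≤ u x ≤ |x|`. -/
theorem stmt2 (a b : ℝ) (ha : 0 < a) (hab : a < b)
    (φ : ℝ → ℝ) (hφ_cont : Continuous φ) (hφ_nonneg : ∀ x, 0 ≤ φ x)
    (hφ_even : ∀ x, φ (-x) = φ x)
    (hφ_supp : Function.support φ ⊆ {x : ℝ | a ≤ |x| ∧ |x| ≤ b})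
    (hφ_int : (∫ z in Ioi (0 : ℝ), φ z) = 1)
    (u : ℝ → ℝ)
    (hu : ∀ x, u x = ∫ y in (0 : ℝ)..|x|, (∫ z in (0 : ℝ)..y, φ z)) :
    ContDiff ℝ 2 u ∧
    (∀ x, deriv (deriv u) x = φ x) ∧
    (∀ x, |deriv u x| ≤ 1) ∧
    (∀ x, |x| - b ≤ u x ∧ u x ≤ |x|) := by
  have h_integrable : IntegrableOn φ (Ioi 0) := by
    by_contra h
    rw [integral_undef h] at hφ_int
    exact zero_ne_one hφ_int
  set F : ℝ → ℝ := fun y => ∫ z in (0 : ℝ)..y, φ z with hF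
  have hF_deriv (x : ℝ) : HasDerivAt F (φ x) x := hφ_cont.integral_hasStrictDerivAt 0 x |>.hasDerivAt
  have hF_cont : Continuous F :=
    continuous_iff_continuousAt.2 fun x => (hF_deriv x).continuousAt
  have hF_odd (y : ℝ) : F (-y) = -F y := integral_zero_neg_of_even hφ_even y
  have hF_nonneg {y : ℝ} (hy : 0 ≤ y) : 0 ≤ F y :=
    integral_nonneg hy fun z _ => hφ_nonneg z
  have hF_add {y : ℝ} (hy : 0 ≤ y) : F y + ∫ z in Ioi y, φ z = 1 := by
    rw [← hφ_int]
    exact integral_interval_add_Ioi h_integrable (h_integrable.mono_set (Ioi_subset_Ioi hy))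
  have hF_le {y : ℝ} (hy : 0 ≤ y) : F y ≤ 1 := by
    have h : 0 ≤ ∫ z in Ioi y, φ z := MeasureTheory.integral_nonneg hφ_nonneg
    linarith [hF_add hy]
  have hF_eq {y : ℝ} (hy : b ≤ y) : F y = 1 := by
    have h : ∫ z in Ioi y, φ z = 0 := by
      refine setIntegral_eq_zero_of_forall_eq_zero fun z hz => ?_
      by_contra hne
      have hzb := (hφ_supp hne).2
      have hyz : y < z := hz
      linarith [le_abs_self z]
    linarith [hF_add ((ha.trans hab).le.trans hy)]
  have hu_eq : u = fun x => ∫ y in (0 : ℝ)..x, F y := by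
    funext x
    rw [hu]
    rcases abs_choice x with h | h <;> rw [h]
    exact integral_zero_neg_of_odd hF_odd x
  have hu_deriv (x : ℝ) : HasDerivAt u (F x) x := by
    rw [hu_eq]
    exact hF_cont.integral_hasStrictDerivAt 0 x |>.hasDerivAt
  have h_deriv_u : deriv u = F := funext fun x => (hu_deriv x).deriv
  have h_deriv_F : deriv F = φ := funext fun x => (hF_deriv x).deriv
  have hF_int (c d : ℝ) : IntervalIntegrable F volume c d := hF_cont.intervalIntegrable c d
  refine ⟨?_, fun x => by rw [h_deriv_u, h_deriv_F], fun x => ?_, fun x => ?_⟩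
  · have hF_C1 : ContDiff ℝ 1 F :=
      contDiff_one_iff_deriv.2 ⟨fun x => (hF_deriv x).differentiableAt, h_deriv_F ▸ hφ_cont⟩
    rw [show (2 : WithTop ℕ∞) = 1 + 1 by norm_num, contDiff_succ_iff_deriv]
    exact ⟨fun x => (hu_deriv x).differentiableAt, by simp, h_deriv_u ▸ hF_C1⟩
  · rw [h_deriv_u]
    rcases le_total 0 x with hx | hx
    · exact abs_le.2 ⟨by linarith [hF_nonneg hx], hF_le hx⟩
    · have hx' : 0 ≤ -x := neg_nonneg.2 hx
      have h₀ := hF_nonneg hx'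
      have h₁ := hF_le hx'
      rw [hF_odd] at h₀ h₁
      exact abs_le.2 ⟨by linarith, by linarith⟩
  · rw [hu]
    have hx := abs_nonneg x
    generalize |x| = r at hx ⊢
    change r - b ≤ ∫ y in (0 : ℝ)..r, F y ∧ (∫ y in (0 : ℝ)..r, F y) ≤ r
    constructor
    · rcases le_total r b with hrb | hbr
      · have h : 0 ≤ ∫ y in (0 : ℝ)..r, F y := integral_nonneg hx fun y hy => hF_nonneg hy.1
        linarith
      · have h₀ : 0 ≤ ∫ y in (0 : ℝ)..b, F y :=
          integral_nonneg (ha.trans hab).le fun y hy => hF_nonneg hy.1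
        have h₁ : ∫ y in b..r, F y = r - b := by
          rw [integral_congr (g := fun _ => (1 : ℝ)) fun y hy => ?_]
          · simp
          · rw [uIcc_of_le hbr] at hy
            exact hF_eq hy.1
        linarith [integral_add_adjacent_intervals (hF_int 0 b) (hF_int b r)]
    · have h := integral_mono_on hx (hF_int 0 r) (intervalIntegrable_const (c := (1 : ℝ)))
        fun y hy => hF_le hy.1
      simpa using h
end

section
/- Define a_m = exp(-m(m+1)/2) for integers m ≥ 0. There exists a constant C > 0 such that for every integer n ≥ 3 there exists an integer m ≥ 1 with a_m · n ≥ 1 (equivalently exp(m(m+1)/2) ≤ n) and a_{m-1} + 1/m + 1/(m a_m n) ≤ C (log n)^{-1/2}. -/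
/-- Every real `L ≥ 1` lies between two consecutive triangular numbers of positive index. -/
theorem exists_triangular_le_lt {L : ℝ} (hL : 1 ≤ L) :
    ∃ m : ℕ, 1 ≤ m ∧ (m : ℝ) * (m + 1) / 2 ≤ L ∧ L < ((m : ℝ) + 1) * (m + 2) / 2 := by
  classical
  have hex : ∃ k : ℕ, L < ((k : ℝ) + 1) * (k + 2) / 2 := by
    obtain ⟨k, hk⟩ := exists_nat_gt L
    exact ⟨k, by nlinarith [sq_nonneg (k : ℝ)]⟩
  have hspec := Nat.find_spec hex
  have hmin : ∀ j < Nat.find hex, ¬ L < ((j : ℝ) + 1) * (j + 2) / 2 :=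
    fun j hj => Nat.find_min hex hj
  generalize Nat.find hex = m at hspec hmin
  obtain _ | j := m
  · norm_num at hspec
    linarith
  · refine ⟨j + 1, by omega, ?_, hspec⟩
    have h := not_lt.mp (hmin j (Nat.lt_succ_self j))
    push_cast
    linarith

theorem Real.exp_neg_triangular_pred_le {m : ℝ} (hm : 1 ≤ m) :
    Real.exp (-((m - 1) * m) / 2) ≤ 2 / m := by
  have h := Real.add_one_le_exp ((m - 1) * m / 2)
  rw [neg_div, Real.exp_neg, inv_le_comm₀ (Real.exp_pos _) (by positivity), inv_div]
  nlinarith [sq_nonneg (m - 1)]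


/-- Choice of the index `m = m_n` in the Yamada–Watanabe method: with
`a m = exp (-m(m+1)/2)`, there is a constant `C > 0` such that for every `n ≥ 3`
there is `m ≥ 1` with `a m · n ≥ 1` and
`a (m-1) + 1/m + 1/(m · a m · n) ≤ C (log n)^{-1/2}`. -/
theorem stmt3 (a : ℕ → ℝ)
    (ha : ∀ m : ℕ, a m = Real.exp (-((m : ℝ) * ((m : ℝ) + 1)) / 2)) :
    ∃ C : ℝ, 0 < C ∧
      ∀ n : ℕ, 3 ≤ n →
        ∃ m : ℕ, 1 ≤ m ∧
          1 ≤ a m * (n : ℝ) ∧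
          a (m - 1) + 1 / (m : ℝ) + 1 / ((m : ℝ) * a m * (n : ℝ)) ≤
            C * (Real.log n) ^ (-(1 : ℝ) / 2) := by
  refine ⟨8, by norm_num, fun n hn => ?_⟩
  have hn3 : (3 : ℝ) ≤ n := by exact_mod_cast hn
  have hn0 : (0 : ℝ) < n := by linarith
  have hL : 1 ≤ Real.log n := by
    rw [Real.le_log_iff_exp_le hn0]
    linarith [Real.exp_one_lt_d9]
  obtain ⟨m, hm, hle, hlt⟩ := exists_triangular_le_lt hL
  have hm1 : (1 : ℝ) ≤ m := by exact_mod_cast hm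
  have hm0 : (0 : ℝ) < m := by linarith
  have han : 1 ≤ a m * (n : ℝ) := by
    rw [ha, ← Real.exp_log hn0, ← Real.exp_add, Real.one_le_exp_iff]
    linarith
  refine ⟨m, hm, han, ?_⟩
  have h1 : a (m - 1) ≤ 2 / m := by
    rw [ha, Nat.cast_sub hm, Nat.cast_one, sub_add_cancel]
    exact Real.exp_neg_triangular_pred_le hm1
  have h2 : 1 / ((m : ℝ) * a m * (n : ℝ)) ≤ 1 / m := by
    apply one_div_le_one_div_of_le hm0
    rw [mul_assoc]
    exact le_mul_of_one_le_right hm0.le han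
  have hsqrt : √(Real.log n) ≤ 2 * m :=
    Real.sqrt_le_iff.mpr ⟨by positivity, by nlinarith⟩
  have hsqrt0 : 0 < √(Real.log n) := Real.sqrt_pos.mpr (by linarith)
  have h3 : (Real.log n) ^ (-(1 : ℝ) / 2) = 1 / √(Real.log n) := by
    rw [neg_div, Real.rpow_neg (by linarith), ← Real.sqrt_eq_rpow, one_div]
  have h4 : 1 / (2 * (m : ℝ)) ≤ 1 / √(Real.log n) :=
    one_div_le_one_div_of_le hsqrt0 hsqrt
  rw [h3]
  calc a (m - 1) + 1 / (m : ℝ) + 1 / ((m : ℝ) * a m * (n : ℝ))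
      ≤ 2 / m + 1 / m + 1 / m := by gcongr
    _ = 8 * (1 / (2 * (m : ℝ))) := by
      field_simp
      norm_num
    _ ≤ 8 * (1 / √(Real.log n)) := by gcongr
end

section
/- Let I ⊆ ℝ be an open interval with a fixed base point c ∈ I, let ε > 0, let f: ℝ → ℝ be nondecreasing and bounded, and let σ: ℝ → ℝ satisfy the Nakao–Le Gall condition: ε ≤ σ(x) for all x ∈ ℝ and |σ(x) - σ(y)|² ≤ |f(x) - f(y)| for all x, y ∈ ℝ. Let b: ℝ → ℝ be measurable, bounded, and integrable on I. Define s'(x) = exp(-2 ∫_c^x b(v) σ(v)^{-2} dv), s(x) = ∫_c^x s'(u) du for x ∈ I, and σ̄ = (σ · s') ∘ s^{-1} on s(I). Then: (i) σ̄(x̄) ≥ ε · exp(-2 ε^{-2} ∫_I |b(v)| dv) > 0 for every x̄ ∈ s(I); and (ii) there exists a bounded nondecreasing function f_b: ℝ → ℝ such that |σ̄(x̄) - σ̄(ȳ)|² ≤ |f_b(x̄) - f_b(ȳ)| for all x̄, ȳ ∈ s(I). In other words, the Nakao–Le Gall condition is invariant under removal of the drift. -/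
open MeasureTheory Set intervalIntegral

theorem Real.abs_exp_sub_exp_le {a b M : ℝ} (ha : a ≤ M) (hb : b ≤ M) :
    |Real.exp a - Real.exp b| ≤ Real.exp M * |a - b| := by
  wlog hab : b ≤ a generalizing a b
  · rw [abs_sub_comm, abs_sub_comm a]
    exact this hb ha (le_of_not_ge hab)
  rw [abs_of_nonneg (sub_nonneg.2 (Real.exp_le_exp.2 hab)), abs_of_nonneg (sub_nonneg.2 hab)]
  have h1 : Real.exp b = Real.exp a * Real.exp (b - a) := by
    rw [← Real.exp_add]; congr 1; ring
  calc Real.exp a - Real.exp b = Real.exp a * (1 - Real.exp (b - a)) := by rw [h1]; ring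
    _ ≤ Real.exp a * (a - b) :=
      mul_le_mul_of_nonneg_left (by linarith [Real.add_one_le_exp (b - a)]) (Real.exp_pos a).le
    _ ≤ Real.exp M * (a - b) := by
      gcongr

theorem intervalIntegrable_of_abs_le {g : ℝ → ℝ} (hg : Measurable g) {C : ℝ}
    (hC : ∀ x, |g x| ≤ C) (x y : ℝ) : IntervalIntegrable g volume x y :=
  (intervalIntegrable_const (c := C)).mono_fun hg.aestronglyMeasurable
    (Filter.Eventually.of_forall fun v => by
      simpa using (hC v).trans (le_abs_self C))

/-- A bounded monotone function on a set extends to a bounded monotone function on the line. -/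
theorem MonotoneOn.exists_bounded_monotone_extension {h : ℝ → ℝ} {t : Set ℝ}
    (hm : MonotoneOn h t) {H : ℝ} (hH : ∀ z ∈ t, |h z| ≤ H) :
    ∃ k : ℝ → ℝ, Monotone k ∧ (∃ K : ℝ, ∀ x, |k x| ≤ K) ∧ EqOn h k t := by
  obtain ⟨k, hk, hkt⟩ := hm.exists_monotone_extension
    ⟨-H, by rintro _ ⟨z, hz, rfl⟩; exact (abs_le.1 (hH z hz)).1⟩
    ⟨H, by rintro _ ⟨z, hz, rfl⟩; exact (abs_le.1 (hH z hz)).2⟩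
  refine ⟨fun x => max (-|H|) (min |H| (k x)), fun x y hxy => ?_, ⟨|H|, fun x => ?_⟩, ?_⟩
  · exact max_le_max le_rfl (min_le_min le_rfl (hk hxy))
  · rw [abs_le]
    exact ⟨le_max_left _ _, max_le (by linarith [abs_nonneg H]) (min_le_left _ _)⟩
  · intro z hz
    have h1 := abs_le.1 ((hH z hz).trans (le_abs_self H))
    simp only [← hkt hz]
    rw [min_eq_right h1.2, max_eq_right h1.1]

theorem sq_abs_mul_sub_mul_le {p q u v E S : ℝ} (hu : |u| ≤ E) (hv : |v| ≤ E) (hq : |q| ≤ S) :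
    |p * u - q * v| ^ 2 ≤ 2 * E ^ 2 * |p - q| ^ 2 + 4 * S ^ 2 * E * |u - v| := by
  have hE : 0 ≤ E := (abs_nonneg u).trans hu
  have huv : |u - v| ≤ 2 * E := (abs_sub u v).trans (by linarith)
  have h1 : |u - v| ^ 2 ≤ 2 * E * |u - v| := by
    rw [sq]; exact mul_le_mul_of_nonneg_right huv (abs_nonneg _)
  have h2 : u ^ 2 ≤ E ^ 2 := sq_le_sq' (abs_le.1 hu).1 (abs_le.1 hu).2
  have h3 : q ^ 2 ≤ S ^ 2 := sq_le_sq' (abs_le.1 hq).1 (abs_le.1 hq).2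
  calc |p * u - q * v| ^ 2 = ((p - q) * u + q * (u - v)) ^ 2 := by rw [sq_abs]; ring
    _ ≤ 2 * (u ^ 2 * (p - q) ^ 2) + 2 * (q ^ 2 * (u - v) ^ 2) := by
      nlinarith [sq_nonneg ((p - q) * u - q * (u - v))]
    _ = 2 * (u ^ 2 * |p - q| ^ 2) + 2 * (q ^ 2 * |u - v| ^ 2) := by rw [sq_abs, sq_abs]
    _ ≤ 2 * (E ^ 2 * |p - q| ^ 2) + 2 * (S ^ 2 * (2 * E * |u - v|)) := by gcongr
    _ = _ := by ring

/-- Lemma 5.1: the Nakao–Le Gall condition is invariant under removal of the drift.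
If `σ ≥ ε` and `|σ x - σ y|² ≤ |f x - f y|` for a bounded nondecreasing `f`, and `b`
is bounded measurable and integrable on the open interval `I`, then the drift-removed
coefficient `σ̄ = (σ s') ∘ s⁻¹` is bounded below by `ε exp(-2 ε⁻² ∫_I |b|) > 0` on
`s(I)` and satisfies a Nakao–Le Gall condition with some bounded nondecreasing `f_b`. -/
theorem stmt8
    (I : Set ℝ) (hIopen : IsOpen I) (hIconn : I.OrdConnected)
    (c : ℝ) (hc : c ∈ I)
    (ε : ℝ) (hε : 0 < ε)
    (f : ℝ → ℝ) (hf_mono : Monotone f) (F : ℝ) (hf_bdd : ∀ x, |f x| ≤ F)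
    (σ : ℝ → ℝ) (hσ_meas : Measurable σ) (hσ_lb : ∀ x, ε ≤ σ x)
    (hNL : ∀ x y, |σ x - σ y| ^ 2 ≤ |f x - f y|)
    (b : ℝ → ℝ) (hb_meas : Measurable b) (B : ℝ) (hb_bdd : ∀ x, |b x| ≤ B)
    (hb_int : IntegrableOn b I)
    (s' : ℝ → ℝ) (hs' : ∀ x, s' x = Real.exp (-2 * ∫ v in c..x, b v / (σ v) ^ 2))
    (s : ℝ → ℝ) (hs : ∀ x, s x = ∫ u in c..x, s' u)
    (σb : ℝ → ℝ)
    (hσb : ∀ z, σb z =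
      σ (Function.invFunOn s I z) * s' (Function.invFunOn s I z)) :
    (0 < ε * Real.exp (-2 * (ε ^ 2)⁻¹ * ∫ v in I, |b v|) ∧
      ∀ z ∈ s '' I, ε * Real.exp (-2 * (ε ^ 2)⁻¹ * ∫ v in I, |b v|) ≤ σb z) ∧
    (∃ fb : ℝ → ℝ, Monotone fb ∧ (∃ Fb : ℝ, ∀ x, |fb x| ≤ Fb) ∧
      ∀ z ∈ s '' I, ∀ w ∈ s '' I, |σb z - σb w| ^ 2 ≤ |fb z - fb w|) := by
  set L : ℝ := ∫ v in I, |b v| with hL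
  set M : ℝ := (ε ^ 2)⁻¹ * L with hM
  set g : ℝ → ℝ := fun v => b v / σ v ^ 2 with hg
  have hb_ii := intervalIntegrable_of_abs_le hb_meas hb_bdd
  have hgb : ∀ v, |g v| ≤ (ε ^ 2)⁻¹ * |b v| := fun v => by
    rw [hg, abs_div, abs_of_nonneg (sq_nonneg (σ v)), div_eq_inv_mul]
    gcongr
    exact hσ_lb v
  have hg_ii := intervalIntegrable_of_abs_le (g := g) (hb_meas.div (hσ_meas.pow_const 2))
    (fun v => (hgb v).trans (mul_le_mul_of_nonneg_left (hb_bdd v) (by positivity)))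
  have hs'_cont : Continuous s' := by
    rw [funext hs']
    exact Real.continuous_exp.comp (continuous_const.mul (continuous_primitive hg_ii c))
  have hs'_pos : ∀ x, 0 < s' x := fun x => by rw [hs']; exact Real.exp_pos _
  have hs_mono : StrictMono s := fun x y hxy => by
    have h1 := intervalIntegral_pos_of_pos (hs'_cont.intervalIntegrable (μ := volume) x y) hs'_pos hxy
    have h2 := integral_interval_sub_left (hs'_cont.intervalIntegrable (μ := volume) c y)
      (hs'_cont.intervalIntegrable (μ := volume) c x)
    rw [hs, hs]
    linarith
  have hinv : ∀ x ∈ I, Function.invFunOn s I (s x) = x := fun x hx =>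
    hs_mono.injective.injOn.leftInvOn_invFunOn hx
  set G : ℝ → ℝ := fun x => ∫ v in c..x, |b v| with hG
  have hG_sub : ∀ x y, G y - G x = ∫ v in x..y, |b v| := fun x y =>
    integral_interval_sub_left (hb_ii c y).abs (hb_ii c x).abs
  have hG_mono : Monotone G := fun x y hxy => by
    have := integral_nonneg (μ := volume) hxy fun v _ => abs_nonneg (b v)
    linarith [hG_sub x y]
  have hG_bdd : ∀ x ∈ I, |G x| ≤ L := fun x hx => by
    have h1 : |G x| ≤ ∫ v in uIoc c x, |b v| := by
      simpa using norm_integral_le_integral_norm_uIoc (f := fun v => |b v|) (a := c) (b := x)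
        (μ := volume)
    refine h1.trans (setIntegral_mono_set hb_int.abs
      (Filter.Eventually.of_forall fun v => abs_nonneg _) (LE.le.eventuallyLE ?_))
    exact uIoc_subset_uIcc.trans (hIconn.uIcc_subset hc hx)
  have hφ_sub : ∀ x y, |(∫ v in c..x, g v) - ∫ v in c..y, g v| ≤ (ε ^ 2)⁻¹ * |G x - G y| :=
    fun x y => by
      rw [integral_interval_sub_left (hg_ii c x) (hg_ii c y), hG_sub]
      wlog hyx : y ≤ x generalizing x y
      · rw [integral_symm, abs_neg, integral_symm x y, abs_neg]
        exact this y x (le_of_not_ge hyx)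
      calc |∫ v in y..x, g v| ≤ ∫ v in y..x, |g v| := abs_integral_le_integral_abs hyx
        _ ≤ ∫ v in y..x, (ε ^ 2)⁻¹ * |b v| :=
          integral_mono_on hyx (hg_ii y x).abs ((hb_ii y x).abs.const_mul _) fun v _ => hgb v
        _ = (ε ^ 2)⁻¹ * ∫ v in y..x, |b v| := integral_const_mul _ _
        _ ≤ _ := by gcongr; exact le_abs_self _
  have hφ_bdd : ∀ x ∈ I, |∫ v in c..x, g v| ≤ M := fun x hx => by
    have h1 := hφ_sub x c
    simp only [hG, integral_same, sub_zero] at h1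
    exact h1.trans (mul_le_mul_of_nonneg_left (hG_bdd x hx) (by positivity))
  set E : ℝ := Real.exp (2 * M) with hE
  have hs'_le : ∀ x ∈ I, |s' x| ≤ E := fun x hx => by
    rw [abs_of_pos (hs'_pos x), hs', hE, Real.exp_le_exp]
    linarith [(abs_le.1 (hφ_bdd x hx)).1]
  have hs'_sub : ∀ x ∈ I, ∀ y ∈ I, |s' x - s' y| ≤ 2 * E * (ε ^ 2)⁻¹ * |G x - G y| :=
    fun x hx y hy => by
      rw [hs', hs']
      refine (Real.abs_exp_sub_exp_le (M := 2 * M)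
        (by linarith [(abs_le.1 (hφ_bdd x hx)).1])
        (by linarith [(abs_le.1 (hφ_bdd y hy)).1])).trans ?_
      rw [← mul_sub, abs_mul, show |(-2 : ℝ)| = 2 by norm_num]
      calc E * (2 * _) ≤ E * (2 * ((ε ^ 2)⁻¹ * |G x - G y|)) := by
            gcongr; exact hφ_sub x y
        _ = _ := by ring
  set S : ℝ := σ c + 1 + 2 * F with hS
  have hσ_bdd : ∀ x, |σ x| ≤ S := fun x => by
    rw [abs_of_pos (hε.trans_le (hσ_lb x))]
    have h1 := hNL x c
    have h2 : |f x - f c| ≤ 2 * F := (abs_sub _ _).trans (by linarith [hf_bdd x, hf_bdd c])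
    nlinarith [le_abs_self (σ x - σ c), sq_nonneg (|σ x - σ c| - 1)]
  refine ⟨⟨by positivity, ?_⟩, ?_⟩
  · rintro _ ⟨x, hx, rfl⟩
    rw [hσb, hinv x hx, hs']
    have h1 := (abs_le.1 (hφ_bdd x hx)).2
    gcongr ?_ * Real.exp ?_
    · exact (hε.trans_le (hσ_lb x)).le
    · exact hσ_lb x
    · rw [mul_assoc]
      linarith
  set C : ℝ := 4 * S ^ 2 * E * (2 * E * (ε ^ 2)⁻¹) with hC
  have hC0 : 0 ≤ C := by positivity
  set h : ℝ → ℝ := fun x => 2 * E ^ 2 * f x + C * G x with hh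
  have h_mono : Monotone h :=
    (hf_mono.const_mul (by positivity)).add (hG_mono.const_mul hC0)
  have h_bdd : ∀ x ∈ I, |h x| ≤ 2 * E ^ 2 * F + C * L := fun x hx => by
    refine (abs_add_le _ _).trans ?_
    rw [abs_mul, abs_mul C, abs_of_nonneg hC0, abs_of_nonneg (by positivity : 0 ≤ 2 * E ^ 2)]
    gcongr
    exacts [hf_bdd x, hG_bdd x hx]
  have h_abs : ∀ x y, 2 * E ^ 2 * |f x - f y| + C * |G x - G y| = |h x - h y| := fun x y => by
    wlog hyx : y ≤ x generalizing x y
    · rw [abs_sub_comm, abs_sub_comm (G x), abs_sub_comm (h x)]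
      exact this y x (le_of_not_ge hyx)
    rw [abs_of_nonneg (sub_nonneg.2 (hf_mono hyx)), abs_of_nonneg (sub_nonneg.2 (hG_mono hyx)),
      abs_of_nonneg (sub_nonneg.2 (h_mono hyx))]
    ring
  have h_inv_mono : MonotoneOn (h ∘ Function.invFunOn s I) (s '' I) := by
    rintro _ ⟨x, hx, rfl⟩ _ ⟨y, hy, rfl⟩ hxy
    simp only [Function.comp, hinv x hx, hinv y hy]
    exact h_mono (hs_mono.le_iff_le.1 hxy)
  obtain ⟨k, hk_mono, hk_bdd, hk⟩ := h_inv_mono.exists_bounded_monotone_extension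
    (H := 2 * E ^ 2 * F + C * L) (by
      rintro _ ⟨x, hx, rfl⟩
      simpa only [Function.comp, hinv x hx] using h_bdd x hx)
  refine ⟨k, hk_mono, hk_bdd, ?_⟩
  rintro _ ⟨x, hx, rfl⟩ _ ⟨y, hy, rfl⟩
  rw [← hk (mem_image_of_mem s hx), ← hk (mem_image_of_mem s hy)]
  simp only [Function.comp, hσb, hinv x hx, hinv y hy]
  calc |σ x * s' x - σ y * s' y| ^ 2
      ≤ 2 * E ^ 2 * |σ x - σ y| ^ 2 + 4 * S ^ 2 * E * |s' x - s' y| :=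
        sq_abs_mul_sub_mul_le (hs'_le x hx) (hs'_le y hy) (hσ_bdd y)
    _ ≤ 2 * E ^ 2 * |f x - f y| + 4 * S ^ 2 * E * (2 * E * (ε ^ 2)⁻¹ * |G x - G y|) := by
        gcongr
        exacts [hNL x y, hs'_sub x hx y hy]
    _ = |h x - h y| := by rw [← h_abs, hC]; ring
end

section
/- Let I ⊆ ℝ be an open interval with base point c ∈ I, let ε > 0 and B ≥ 0, let σ: ℝ → ℝ be measurable with σ(x) ≥ ε for all x, and let b: ℝ → ℝ be measurable with |b(x)| ≤ B for all x and b integrable on I. Define s'(x) = exp(-2 ∫_c^x b(v) σ(v)^{-2} dv). Then s' is Lipschitz continuous on I with |s'(x) - s'(y)| ≤ 2 B ε^{-2} exp(2 ε^{-2} ∫_I |b(v)| dv) · |x - y| for all x, y ∈ I. -/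
open MeasureTheory Set intervalIntegral

theorem abs_exp_sub_exp_le {u v K : ℝ} (hu : u ≤ K) (hv : v ≤ K) :
    |Real.exp u - Real.exp v| ≤ Real.exp K * |u - v| := by
  wlog h : v ≤ u generalizing u v
  · rw [abs_sub_comm, abs_sub_comm u]
    exact this hv hu (le_of_not_ge h)
  rw [abs_of_nonneg (sub_nonneg.2 (Real.exp_le_exp.2 h)), abs_of_nonneg (sub_nonneg.2 h)]
  calc Real.exp u - Real.exp v = Real.exp u * (1 - Real.exp (v - u)) := by
        rw [mul_sub, ← Real.exp_add]; ring_nf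
    _ ≤ Real.exp u * (u - v) := by
        refine mul_le_mul_of_nonneg_left ?_ (Real.exp_nonneg u)
        linarith [Real.add_one_le_exp (v - u)]
    _ ≤ Real.exp K * (u - v) := by
        have := sub_nonneg.2 h
        gcongr

/-- Lipschitz continuity of the scale-function derivative
`s'(x) = exp(-2 ∫_c^x b σ⁻² dv)` on `I`, with Lipschitz constant
`2 B ε⁻² exp(2 ε⁻² ∫_I |b|)`. -/
theorem stmt10
    (I : Set ℝ) (hIopen : IsOpen I) (hIconn : I.OrdConnected)
    (c : ℝ) (hc : c ∈ I)
    (ε B : ℝ) (hε : 0 < ε) (hB : 0 ≤ B)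
    (σ : ℝ → ℝ) (hσ_meas : Measurable σ) (hσ_lb : ∀ x, ε ≤ σ x)
    (b : ℝ → ℝ) (hb_meas : Measurable b) (hb_bdd : ∀ x, |b x| ≤ B)
    (hb_int : IntegrableOn b I)
    (s' : ℝ → ℝ) (hs' : ∀ x, s' x = Real.exp (-2 * ∫ v in c..x, b v / (σ v) ^ 2)) :
    ∀ x ∈ I, ∀ y ∈ I,
      |s' x - s' y| ≤
        2 * B * (ε ^ 2)⁻¹ * Real.exp (2 * (ε ^ 2)⁻¹ * ∫ v in I, |b v|) * |x - y| := by
  have quotient_le (v : ℝ) : |b v / σ v ^ 2| ≤ (ε ^ 2)⁻¹ * |b v| := by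
    rw [abs_div, abs_of_nonneg (sq_nonneg (σ v)), div_eq_inv_mul]
    have := hσ_lb v
    gcongr
  have quotient_le_const (v : ℝ) : ‖b v / σ v ^ 2‖ ≤ (ε ^ 2)⁻¹ * B :=
    (quotient_le v).trans (by have := hb_bdd v; gcongr)
  have intervalIntegrable_quotient (p q : ℝ) :
      IntervalIntegrable (fun v ↦ b v / σ v ^ 2) volume p q :=
    (intervalIntegrable_const (c := (ε ^ 2)⁻¹ * B)).mono_fun'
      (hb_meas.div (hσ_meas.pow_const 2)).aestronglyMeasurable
      (Filter.Eventually.of_forall quotient_le_const)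
  have exponent_le {x : ℝ} (hx : x ∈ I) :
      -2 * ∫ v in c..x, b v / σ v ^ 2 ≤ 2 * (ε ^ 2)⁻¹ * ∫ v in I, |b v| := by
    have hsub : uIoc c x ⊆ I := uIoc_subset_uIcc.trans (hIconn.uIcc_subset hc hx)
    have hb_abs : IntegrableOn (fun v ↦ |b v|) I := hb_int.abs
    have : |∫ v in c..x, b v / σ v ^ 2| ≤ (ε ^ 2)⁻¹ * ∫ v in I, |b v| :=
      calc |∫ v in c..x, b v / σ v ^ 2| ≤ ∫ v in uIoc c x, |b v / σ v ^ 2| :=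
            norm_integral_le_integral_norm_uIoc (f := fun v ↦ b v / σ v ^ 2)
        _ ≤ ∫ v in uIoc c x, (ε ^ 2)⁻¹ * |b v| :=
            setIntegral_mono (intervalIntegrable_quotient c x).def'.abs
              ((hb_abs.mono_set hsub).const_mul _) quotient_le
        _ ≤ ∫ v in I, (ε ^ 2)⁻¹ * |b v| :=
            setIntegral_mono_set (hb_abs.const_mul _)
              (Filter.Eventually.of_forall fun v ↦ by positivity) hsub.eventuallyLE
        _ = (ε ^ 2)⁻¹ * ∫ v in I, |b v| := MeasureTheory.integral_const_mul _ _
    linarith [neg_abs_le (∫ v in c..x, b v / σ v ^ 2)]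
  intro x hx y hy
  rw [hs', hs']
  refine (abs_exp_sub_exp_le (exponent_le hx) (exponent_le hy)).trans ?_
  rw [← mul_sub, integral_interval_sub_left (intervalIntegrable_quotient c x)
    (intervalIntegrable_quotient c y), abs_mul, abs_neg, abs_two]
  have : |∫ v in y..x, b v / σ v ^ 2| ≤ (ε ^ 2)⁻¹ * B * |x - y| :=
    norm_integral_le_of_norm_le_const fun v _ ↦ quotient_le_const v
  calc _ ≤ Real.exp (2 * (ε ^ 2)⁻¹ * ∫ v in I, |b v|) * (2 * ((ε ^ 2)⁻¹ * B * |x - y|)) := by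
        gcongr
    _ = _ := by ring
end

section
/- Let F > 0, c₂ > 0, δ ≥ 0. Let f: ℝ → ℝ be nondecreasing with |f(x)| ≤ F for all x. Let g, g̃: ℝ → ℝ satisfy g(y) - g(x) ≥ (y - x)/c₂ and g̃(y) - g̃(x) ≥ (y - x)/c₂ for all x ≤ y, and sup_{x ∈ ℝ} |g(x) - g̃(x)| ≤ δ. Then ∫_ℝ |f(g̃(x)) - f(g(x))| dx ≤ 4 F c₂ δ. -/
open MeasureTheory

/-- The increment `h (x + a) - h (x - a)` of a nondecreasing function with `|h| ≤ F` has integral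
at most `4 * F * a` over `ℝ`. -/
theorem Monotone.lintegral_increment_le {h : ℝ → ℝ} (hm : Monotone h) {F : ℝ}
    (hF : ∀ x, |h x| ≤ F) {a : ℝ} (ha : 0 ≤ a) :
    ∫⁻ x, ENNReal.ofReal (h (x + a) - h (x - a)) ≤ ENNReal.ofReal (4 * F * a) := by
  have hp : Monotone fun x => h (x + a) := fun x y hxy => hm (by linarith)
  have hn : Monotone fun x => h (x - a) := fun x y hxy => hm (by linarith)
  have cover : AECover (volume : Measure ℝ) Filter.atTop fun n : ℕ => Set.Ioc (-(n : ℝ)) n :=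
    aecover_Ioc (Filter.tendsto_neg_atTop_atBot.comp tendsto_natCast_atTop_atTop)
      tendsto_natCast_atTop_atTop
  refine le_of_tendsto' (cover.lintegral_tendsto_of_countably_generated
    (hp.measurable.sub hn.measurable).ennreal_ofReal.aemeasurable) fun n => ?_
  have hle : -(n : ℝ) ≤ n := by linarith [n.cast_nonneg (α := ℝ)]
  have hii : ∀ u v, IntervalIntegrable h volume u v := fun u v => hm.intervalIntegrable
  have hpi : IntervalIntegrable (fun x => h (x + a)) volume (-(n : ℝ)) n := hp.intervalIntegrable
  have hni : IntervalIntegrable (fun x => h (x - a)) volume (-(n : ℝ)) n := hn.intervalIntegrable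
  have hint := hpi.sub hni
  rw [intervalIntegrable_iff_integrableOn_Ioc_of_le hle] at hint
  rw [← ofReal_integral_eq_lintegral_ofReal hint
    (Filter.Eventually.of_forall fun x => sub_nonneg.2 (hm (by linarith)))]
  refine ENNReal.ofReal_le_ofReal ?_
  rw [← intervalIntegral.integral_of_le hle, intervalIntegral.integral_sub hpi hni,
    intervalIntegral.integral_comp_add_right, intervalIntegral.integral_comp_sub_right,
    intervalIntegral.integral_interval_sub_interval_comm' (hii _ _) (hii _ _) (hii _ _)]
  have bound : ∀ u, |∫ x in (u - a)..(u + a), h x| ≤ F * (2 * a) := fun u => by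
    have := intervalIntegral.norm_integral_le_of_norm_le_const (a := u - a) (b := u + a)
      (f := h) (C := F) fun x _ => hF x
    rwa [show u + a - (u - a) = 2 * a by ring, abs_of_nonneg (by linarith)] at this
  have hr := (abs_le.1 (bound n)).2
  have hl := (abs_le.1 (bound (-n))).1
  linarith

/-- If `f` is nondecreasing with `|f| ≤ F`, and `g, g̃` grow at least like `x/c₂`
with `sup |g - g̃| ≤ δ`, then `∫_ℝ |f ∘ g̃ - f ∘ g| ≤ 4 F c₂ δ`. -/
theorem stmt13
    (F c₂ δ : ℝ) (hF : 0 < F) (hc₂ : 0 < c₂) (hδ : 0 ≤ δ)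
    (f : ℝ → ℝ) (hf_mono : Monotone f) (hf_bdd : ∀ x, |f x| ≤ F)
    (g gt : ℝ → ℝ)
    (hg : ∀ x y : ℝ, x ≤ y → (y - x) / c₂ ≤ g y - g x)
    (hgt : ∀ x y : ℝ, x ≤ y → (y - x) / c₂ ≤ gt y - gt x)
    (hclose : ∀ x, |g x - gt x| ≤ δ) :
    (∫⁻ x : ℝ, ENNReal.ofReal |f (gt x) - f (g x)|) ≤
      ENNReal.ofReal (4 * F * c₂ * δ) := by
  have ha : 0 ≤ c₂ * δ := mul_nonneg hc₂.le hδ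
  have hm : Monotone (f ∘ g) := hf_mono.comp fun x y hxy =>
    sub_nonneg.1 ((div_nonneg (sub_nonneg.2 hxy) hc₂.le).trans (hg x y hxy))
  rw [mul_assoc (4 * F)]
  refine (lintegral_mono fun x => ENNReal.ofReal_le_ofReal ?_).trans
    (hm.lintegral_increment_le (fun x => hf_bdd (g x)) ha)
  have hr := hg x (x + c₂ * δ) (by linarith)
  have hl := hg (x - c₂ * δ) x (by linarith)
  rw [add_sub_cancel_left, mul_div_cancel_left₀ _ hc₂.ne'] at hr
  rw [sub_sub_cancel, mul_div_cancel_left₀ _ hc₂.ne'] at hl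
  have hd := abs_le.1 (hclose x)
  have h₁ : f (gt x) ≤ f (g (x + c₂ * δ)) := hf_mono (by linarith)
  have h₂ : f (g (x - c₂ * δ)) ≤ f (gt x) := hf_mono (by linarith)
  have h₃ : f (g x) ≤ f (g (x + c₂ * δ)) := hf_mono (by linarith)
  have h₄ : f (g (x - c₂ * δ)) ≤ f (g x) := hf_mono (by linarith)
  exact abs_le.2 ⟨by simp only [Function.comp_apply]; linarith,
    by simp only [Function.comp_apply]; linarith⟩
end

section
/- Let I ⊆ ℝ be an open interval, 0 < c₁ ≤ c₂, L ≥ 0, δ₀ ≥ 0, δ ≥ 0, and let s, s̃: I → ℝ be differentiable with c₁ ≤ s'(x) ≤ c₂ and c₁ ≤ s̃'(x) ≤ c₂ for all x ∈ I, with |s'(x) - s'(y)| ≤ L |x - y| for all x, y ∈ I, sup_{x ∈ I} |s(x) - s̃(x)| ≤ δ₀, and sup_{x ∈ I} |s'(x) - s̃'(x)| ≤ δ. Then for every x̄ ∈ s(I) ∩ s̃(I), the derivatives of the inverse functions satisfy |(s^{-1})'(x̄) - (s̃^{-1})'(x̄)| ≤ (δ + L δ₀ / c₁) / c₁². -/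
open Set

/-- A function whose derivative is at least `c` on an order-connected set expands distances
by a factor at least `c`. -/
theorem mul_abs_sub_le_abs_image_sub_of_le_hasDerivAt {I : Set ℝ} (hI : I.OrdConnected)
    {c : ℝ} {f f' : ℝ → ℝ} (hf : ∀ x ∈ I, HasDerivAt f (f' x) x) (hc : ∀ x ∈ I, c ≤ f' x)
    {x y : ℝ} (hx : x ∈ I) (hy : y ∈ I) : c * |x - y| ≤ |f x - f y| := by
  wlog hxy : x ≤ y generalizing x y
  · rw [abs_sub_comm x, abs_sub_comm (f x)]
    exact this hy hx (le_of_not_ge hxy)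
  have h : c * (y - x) ≤ f y - f x :=
    hI.convex.mul_sub_le_image_sub_of_le_deriv
      (fun z hz => (hf z hz).continuousAt.continuousWithinAt)
      (fun z hz => (hf z (interior_subset hz)).differentiableAt.differentiableWithinAt)
      (fun z hz => (hf z (interior_subset hz)).deriv ▸ hc z (interior_subset hz)) x hx y hy hxy
  rw [abs_sub_comm x, abs_sub_comm (f x), abs_of_nonneg (sub_nonneg.2 hxy)]
  exact h.trans (le_abs_self _)

/-- Comparison of the derivatives of inverse scale functions: under two-sided bounds
`c₁ ≤ s', s̃' ≤ c₂` on `I`, a Lipschitz bound `L` for `s'`, `sup_I |s - s̃| ≤ δ₀`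
and `sup_I |s' - s̃'| ≤ δ`, one has
`|1/s'(s⁻¹ x̄) - 1/s̃'(s̃⁻¹ x̄)| ≤ (δ + L δ₀ / c₁) / c₁²` on `s(I) ∩ s̃(I)`. -/
theorem stmt16
    (I : Set ℝ) (hIopen : IsOpen I) (hIconn : I.OrdConnected)
    (c₁ c₂ L δ₀ δ : ℝ) (hc₁ : 0 < c₁) (hc₁₂ : c₁ ≤ c₂) (hL : 0 ≤ L)
    (hδ₀ : 0 ≤ δ₀) (hδ : 0 ≤ δ)
    (s st s' st' : ℝ → ℝ)
    (hs_deriv : ∀ x ∈ I, HasDerivAt s (s' x) x)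
    (hst_deriv : ∀ x ∈ I, HasDerivAt st (st' x) x)
    (hs'_bd : ∀ x ∈ I, c₁ ≤ s' x ∧ s' x ≤ c₂)
    (hst'_bd : ∀ x ∈ I, c₁ ≤ st' x ∧ st' x ≤ c₂)
    (hs'_lip : ∀ x ∈ I, ∀ y ∈ I, |s' x - s' y| ≤ L * |x - y|)
    (hclose₀ : ∀ x ∈ I, |s x - st x| ≤ δ₀)
    (hclose : ∀ x ∈ I, |s' x - st' x| ≤ δ) :
    ∀ z ∈ (s '' I) ∩ (st '' I),
      |(s' (Function.invFunOn s I z))⁻¹ - (st' (Function.invFunOn st I z))⁻¹| ≤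
        (δ + L * δ₀ / c₁) / c₁ ^ 2 := by
  rintro z ⟨hz, hzt⟩
  have ha := Function.invFunOn_mem hz
  have hb := Function.invFunOn_mem hzt
  have hsa := Function.invFunOn_eq hz
  have hsb := Function.invFunOn_eq hzt
  set a := Function.invFunOn s I z
  set b := Function.invFunOn st I z
  have hab : |a - b| ≤ δ₀ / c₁ := by
    rw [le_div_iff₀' hc₁]
    calc c₁ * |a - b| ≤ |s a - s b| :=
          mul_abs_sub_le_abs_image_sub_of_le_hasDerivAt hIconn hs_deriv
            (fun x hx => (hs'_bd x hx).1) ha hb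
      _ = |s b - st b| := by rw [hsa, hsb, abs_sub_comm]
      _ ≤ δ₀ := hclose₀ b hb
  have hnum : |st' b - s' a| ≤ δ + L * δ₀ / c₁ := by
    calc |st' b - s' a| = |s' a - st' b| := abs_sub_comm _ _
      _ ≤ |s' a - s' b| + |s' b - st' b| := abs_sub_le _ _ _
      _ ≤ L * (δ₀ / c₁) + δ :=
          add_le_add ((hs'_lip a ha b hb).trans (mul_le_mul_of_nonneg_left hab hL)) (hclose b hb)
      _ = δ + L * δ₀ / c₁ := by ring
  have hsa_pos : 0 < s' a := hc₁.trans_le (hs'_bd a ha).1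
  have hstb_pos : 0 < st' b := hc₁.trans_le (hst'_bd b hb).1
  rw [inv_sub_inv hsa_pos.ne' hstb_pos.ne', abs_div, abs_of_pos (mul_pos hsa_pos hstb_pos), sq]
  exact div_le_div₀ ((abs_nonneg _).trans hnum) hnum (mul_pos hc₁ hc₁)
    (mul_le_mul (hs'_bd a ha).1 (hst'_bd b hb).1 hc₁.le hsa_pos.le)
end
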